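/- arXiv:2104.10528 — 2 statements merged into one kernel-verified Lean document; each statement's English description precedes it below -/
import Mathlib

section
/- Let k ≥ 0. The function f_k has no fixed point in the half-open interval [0,1) if and only if all three of the following conditions hold: f_k(0) > 0, f_k(1) = 1, and d(k) ≤ 1. -/
open MeasureTheory Set Filter Topology
open scoped ENNReal NNReal

/-- The space `S = {I,II} × [0,∞) × ℕ`; `true` stands for Player I,
`false` for Player II. -/
abbrev GameS : Type := Bool × ℝ≥0 × ℕ

/-- `pk p i k n = p({ι = i} ∩ {γ ≥ k} ∩ {ξ = n})`. -/
noncomputable def pk (p : Measure GameS) (i : Bool) (k : ℝ≥0) (n : ℕ) : ℝ :=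
  (p {s : GameS | s.1 = i ∧ k ≤ s.2.1 ∧ s.2.2 = n}).toReal

/-- The generating function `G_i(k,x) = Σ_n p_i(k,n) xⁿ`. -/
noncomputable def Gk (p : Measure GameS) (i : Bool) (k : ℝ≥0) (x : ℝ) : ℝ :=
  ∑' n : ℕ, pk p i k n * x ^ n

/-- The value generating function
`f(k,x) = 1 − G_I(k,0) − G_I(k,1) + G_I(k,x) − G_II(k,1−x)`. -/
noncomputable def vgf (p : Measure GameS) (k : ℝ≥0) (x : ℝ) : ℝ :=
  1 - Gk p true k 0 - Gk p true k 1 + Gk p true k x - Gk p false k (1 - x)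

/-- `d(k) = E_p[1_{ι = I, γ ≥ k}·ξ] + p({ι = II} ∩ {γ ≥ k} ∩ {ξ = 1}) ∈ [0,∞]`. -/
noncomputable def dk (p : Measure GameS) (k : ℝ≥0) : ℝ≥0∞ :=
  (∫⁻ s in {s : GameS | s.1 = true ∧ k ≤ s.2.1}, (s.2.2 : ℝ≥0∞) ∂p)
    + p {s : GameS | s.1 = false ∧ k ≤ s.2.1 ∧ s.2.2 = 1}


section PowerSeries

variable {a b : ℕ → ℝ} {x : ℝ}

lemma summable_mul_pow_of_mem_Icc (ha : ∀ n, 0 ≤ a n) (hs : Summable a)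
    (hx : x ∈ Icc (0:ℝ) 1) : Summable fun n => a n * x ^ n :=
  Summable.of_nonneg_of_le (fun n => mul_nonneg (ha n) (pow_nonneg hx.1 n))
    (fun n => mul_le_of_le_one_right (ha n) (pow_le_one₀ hx.1 hx.2)) hs

lemma continuousOn_tsum_mul_pow (ha : ∀ n, 0 ≤ a n) (hs : Summable a) :
    ContinuousOn (fun x : ℝ => ∑' n, a n * x ^ n) (Icc 0 1) := by
  refine continuousOn_tsum (u := a) (fun n => by fun_prop) hs fun n x hx => ?_
  rw [Real.norm_of_nonneg (mul_nonneg (ha n) (pow_nonneg hx.1 n))]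
  exact mul_le_of_le_one_right (ha n) (pow_le_one₀ hx.1 hx.2)

lemma tsum_mul_zero_pow (a : ℕ → ℝ) : ∑' n, a n * (0:ℝ) ^ n = a 0 := by
  rw [tsum_eq_single 0 fun n hn => by simp [hn]]
  simp

/-- A chord bound for the geometric sum `(1 - x ^ n) / (1 - x)`, which is convex in `x`. -/
lemma one_sub_pow_le_chord (hx : x ∈ Icc (0:ℝ) 1) {n : ℕ} (hn : n ≠ 0) :
    1 - x ^ n ≤ (1 - x) * (x * n + (1 - x)) := by
  have h1 : 0 ≤ 1 - x := sub_nonneg.2 hx.2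
  induction n with
  | zero => contradiction
  | succ n ih =>
    rcases eq_or_ne n 0 with rfl | hn'
    · simp
    · have hle : x ^ n ≤ x := pow_le_of_le_one hx.1 hx.2 hn'
      have := mul_le_mul_of_nonneg_right hle h1
      have := ih hn'
      push_cast
      rw [pow_succ]
      linarith

lemma pow_le_sq_of_two_le (hx : x ∈ Icc (0:ℝ) 1) {n : ℕ} (hn : 2 ≤ n) :
    (1 - x) ^ n ≤ (1 - x) ^ 2 :=
  pow_le_pow_of_le_one (sub_nonneg.2 hx.2) (by linarith [hx.1]) hn

lemma tsum_mul_one_sub_pow_le (ha : ∀ n, 0 ≤ a n) (hs : Summable a) (ha0 : a 0 = 0)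
    {c : ℝ} (hc : ∀ N, ∑ n ∈ Finset.range N, a n * n ≤ c) (hx : x ∈ Icc (0:ℝ) 1) :
    ∑' n, a n - ∑' n, a n * x ^ n ≤ (1 - x) * (x * c + (1 - x) * ∑' n, a n) := by
  have h1 : 0 ≤ 1 - x := sub_nonneg.2 hx.2
  rw [← hs.tsum_sub (summable_mul_pow_of_mem_Icc ha hs hx)]
  refine Real.tsum_le_of_sum_range_le
    (fun n => sub_nonneg.2 (mul_le_of_le_one_right (ha n) (pow_le_one₀ hx.1 hx.2))) fun N => ?_
  calc ∑ n ∈ Finset.range N, (a n - a n * x ^ n)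
      ≤ ∑ n ∈ Finset.range N, ((1 - x) * x * (a n * n) + (1 - x) * (1 - x) * a n) := by
        refine Finset.sum_le_sum fun n _ => ?_
        rcases eq_or_ne n 0 with rfl | hn
        · simp [ha0]
        · have := mul_le_mul_of_nonneg_left (one_sub_pow_le_chord hx hn) (ha n)
          linarith
    _ = (1 - x) * x * (∑ n ∈ Finset.range N, a n * n)
          + (1 - x) * (1 - x) * ∑ n ∈ Finset.range N, a n := by
        rw [Finset.sum_add_distrib, Finset.mul_sum, Finset.mul_sum]
    _ ≤ (1 - x) * x * c + (1 - x) * (1 - x) * ∑' n, a n :=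
        add_le_add (mul_le_mul_of_nonneg_left (hc N) (mul_nonneg h1 hx.1))
          (mul_le_mul_of_nonneg_left (hs.sum_le_tsum _ fun n _ => ha n) (mul_nonneg h1 h1))
    _ = (1 - x) * (x * c + (1 - x) * ∑' n, a n) := by ring

lemma tsum_mul_one_sub_pow_le_of_coeff_one (hb : ∀ n, 0 ≤ b n) (hs : Summable b)
    (hb0 : b 0 = 0) (hx : x ∈ Icc (0:ℝ) 1) :
    ∑' n, b n * (1 - x) ^ n ≤ (1 - x) * (x * b 1 + (1 - x) * ∑' n, b n) := by
  have h1 : 0 ≤ 1 - x := sub_nonneg.2 hx.2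
  have hsingle : HasSum (fun n => if n = 1 then (1 - x) * x * b 1 else 0)
      ((1 - x) * x * b 1) := hasSum_ite_eq 1 _
  have hsum := hsingle.add (hs.hasSum.mul_left ((1 - x) * (1 - x)))
  have hsx := summable_mul_pow_of_mem_Icc hb hs (x := 1 - x) ⟨h1, by linarith [hx.1]⟩
  refine (hasSum_le ?_ hsx.hasSum hsum).trans (by linarith)
  intro n
  match n with
  | 0 => simp [hb0]
  | 1 => simp only [↓reduceIte, pow_one]; linarith
  | n + 2 =>
    have := mul_le_mul_of_nonneg_left
      (pow_le_sq_of_two_le hx (Nat.le_add_left 2 n)) (hb (n + 2))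
    simp only [if_neg (by omega : ¬ n + 2 = 1), zero_add]
    linarith

/-- If the left derivative at `1` exceeds `1`, the series lies below the diagonal near `1`. -/
lemma exists_series_lt_self (ha : ∀ n, 0 ≤ a n) (hs : Summable a)
    (hb : ∀ n, 0 ≤ b n) (hsb : Summable b) {N : ℕ}
    (hN : 1 < (∑ n ∈ Finset.range N, a n * n) + b 1) :
    ∃ x ∈ Ioo (0:ℝ) 1, 1 - ∑' n, a n + ∑' n, a n * x ^ n - ∑' n, b n * (1 - x) ^ n < x := by
  let q : ℝ → ℝ := fun x =>
    (∑ n ∈ Finset.range N, a n * ∑ j ∈ Finset.range n, x ^ j) + b 1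
  have hq : Continuous q := by fun_prop
  have hq1 : 1 < q 1 := by simpa [q] using hN
  have hev : ∀ᶠ x in 𝓝[<] (1:ℝ), 1 < q x :=
    nhdsWithin_le_nhds (hq.continuousAt.eventually (lt_mem_nhds hq1))
  obtain ⟨x, hqx, hx⟩ := (hev.and (Ioo_mem_nhdsLT zero_lt_one)).exists
  refine ⟨x, hx, ?_⟩
  have hxI : x ∈ Icc (0:ℝ) 1 := Ioo_subset_Icc_self hx
  have hyI : 1 - x ∈ Icc (0:ℝ) 1 := ⟨by linarith [hx.2], by linarith [hx.1]⟩
  have hsx := summable_mul_pow_of_mem_Icc ha hs hxI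
  have hA : ∑ n ∈ Finset.range N, (a n - a n * x ^ n) ≤ ∑' n, a n - ∑' n, a n * x ^ n := by
    rw [← hs.tsum_sub hsx]
    exact (hs.sub hsx).sum_le_tsum _ fun n _ =>
      sub_nonneg.2 (mul_le_of_le_one_right (ha n) (pow_le_one₀ hxI.1 hxI.2))
  have hB : b 1 * (1 - x) ≤ ∑' n, b n * (1 - x) ^ n := by
    simpa using (summable_mul_pow_of_mem_Icc hb hsb hyI).le_tsum 1
      fun n _ => mul_nonneg (hb n) (pow_nonneg hyI.1 n)
  have hE : (1 - x) * q x = (∑ n ∈ Finset.range N, (a n - a n * x ^ n)) + b 1 * (1 - x) := by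
    simp only [q, mul_add, Finset.mul_sum]
    congr 1
    · refine Finset.sum_congr rfl fun n _ => ?_
      rw [← Finset.mul_sum, ← Finset.mul_sum]
      linear_combination a n * mul_neg_geom_sum x n
    · ring
  have := mul_lt_mul_of_pos_left hqx (sub_pos.2 hx.2)
  linarith

lemma series_no_fixed_point_iff (ha : ∀ n, 0 ≤ a n) (hs : Summable a)
    (hb : ∀ n, 0 ≤ b n) (hsb : Summable b) (hab : ∑' n, a n + ∑' n, b n ≤ 1)
    {f : ℝ → ℝ}
    (hf : ∀ x, f x = 1 - a 0 - ∑' n, a n + ∑' n, a n * x ^ n - ∑' n, b n * (1 - x) ^ n) :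
    (¬ ∃ x ∈ Ico (0:ℝ) 1, f x = x) ↔
      (0 < f 0 ∧ f 1 = 1 ∧ ∀ N, (∑ n ∈ Finset.range N, a n * n) + b 1 ≤ 1) := by
  have hf0 : f 0 = 1 - ∑' n, a n - ∑' n, b n := by
    rw [hf, tsum_mul_zero_pow]; simp; ring
  have hf1 : f 1 = 1 - a 0 - b 0 := by
    rw [hf, sub_self, tsum_mul_zero_pow]; simp
  have hcont : ContinuousOn f (Icc 0 1) := by
    have hfun : f = fun x => 1 - a 0 - ∑' n, a n + ∑' n, a n * x ^ n
        - ∑' n, b n * (1 - x) ^ n := funext hf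
    rw [hfun]
    refine (continuousOn_const.add (continuousOn_tsum_mul_pow ha hs)).sub
      ((continuousOn_tsum_mul_pow hb hsb).comp (f := fun x : ℝ => 1 - x) (by fun_prop) ?_)
    exact fun x hx => ⟨by linarith [hx.2], by linarith [hx.1]⟩
  have hf0n : 0 ≤ f 0 := by linarith
  have ivt : ∀ y ∈ Icc (0:ℝ) 1, f y < y → ∃ x ∈ Ico (0:ℝ) 1, f x = x := by
    intro y hy hlt
    obtain ⟨x, hx, hfx⟩ := intermediate_value_Icc' (f := fun x => f x - x) hy.1
      ((hcont.mono (Icc_subset_Icc_right hy.2)).sub continuousOn_id)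
      (show (0:ℝ) ∈ Icc (f y - y) (f 0 - 0) from ⟨by linarith, by linarith⟩)
    have hfx : f x = x := sub_eq_zero.1 hfx
    refine ⟨x, ⟨hx.1, lt_of_lt_of_le (lt_of_le_of_ne hx.2 ?_) hy.2⟩, hfx⟩
    rintro rfl
    linarith
  constructor
  · intro h
    have h1 : f 1 = 1 := by
      refine le_antisymm (by linarith [ha 0, hb 0]) (not_lt.1 fun hlt => h ?_)
      exact ivt 1 (by simp) hlt
    refine ⟨lt_of_le_of_ne hf0n fun h0 => h ⟨0, by simp, h0.symm⟩, h1, fun N => ?_⟩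
    by_contra! hN
    obtain ⟨x, hx, hlt⟩ := exists_series_lt_self ha hs hb hsb hN
    refine h (ivt x (Ioo_subset_Icc_self hx) ?_)
    rw [hf]
    linarith [ha 0]
  · rintro ⟨h0, h1, hd⟩ ⟨x, hx, hfx⟩
    have ha0 : a 0 = 0 := by linarith [ha 0, hb 0]
    have hb0 : b 0 = 0 := by linarith [ha 0, hb 0]
    have hxI : x ∈ Icc (0:ℝ) 1 := Ico_subset_Icc_self hx
    have hA := tsum_mul_one_sub_pow_le ha hs ha0 (c := 1 - b 1)
      (fun N => by linarith [hd N]) hxI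
    have hB := tsum_mul_one_sub_pow_le_of_coeff_one hb hsb hb0 hxI
    rw [hf, ha0] at hfx
    have hy : 0 < 1 - x := sub_pos.2 hx.2
    have : 0 < (1 - x) * ((1 - x) * (1 - ∑' n, a n - ∑' n, b n)) := by
      rw [hf0] at h0; positivity
    linarith

end PowerSeries

section Measure

variable (p : Measure GameS) (i : Bool) (k : ℝ≥0)

lemma measurableSet_player_capacity : MeasurableSet {s : GameS | s.1 = i ∧ k ≤ s.2.1} :=
  (measurableSet_eq_fun measurable_fst measurable_const).inter
    (measurableSet_le measurable_const (by fun_prop))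

/-- The law of the number of children on `{ι = i} ∩ {γ ≥ k}`. -/
lemma map_children_singleton (n : ℕ) :
    (p.restrict {s : GameS | s.1 = i ∧ k ≤ s.2.1}).map (fun s => s.2.2) {n}
      = p {s : GameS | s.1 = i ∧ k ≤ s.2.1 ∧ s.2.2 = n} := by
  have hm : Measurable fun s : GameS => s.2.2 := by fun_prop
  rw [Measure.map_apply hm (measurableSet_singleton n),
    Measure.restrict_apply (hm (measurableSet_singleton n))]
  congr 1
  ext s
  simp only [mem_inter_iff, mem_preimage, mem_singleton_iff, mem_ofPred_eq]
  tauto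

lemma lintegral_children_eq_tsum (g : ℕ → ℝ≥0∞) :
    ∫⁻ s in {s : GameS | s.1 = i ∧ k ≤ s.2.1}, g s.2.2 ∂p
      = ∑' n, g n * p {s : GameS | s.1 = i ∧ k ≤ s.2.1 ∧ s.2.2 = n} := by
  simp_rw [← map_children_singleton]
  rw [← lintegral_countable', lintegral_map (by fun_prop) (by fun_prop)]

lemma tsum_measure_children :
    ∑' n, p {s : GameS | s.1 = i ∧ k ≤ s.2.1 ∧ s.2.2 = n}
      = p {s : GameS | s.1 = i ∧ k ≤ s.2.1} := by
  simpa using (lintegral_children_eq_tsum p i k fun _ => 1).symm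

variable [IsProbabilityMeasure p]

lemma hasSum_pk : HasSum (pk p i k) (p {s : GameS | s.1 = i ∧ k ≤ s.2.1}).toReal := by
  have := ENNReal.hasSum_toReal (f := fun n => p {s : GameS | s.1 = i ∧ k ≤ s.2.1 ∧ s.2.2 = n})
    (by rw [tsum_measure_children]; exact measure_ne_top p _)
  rwa [← ENNReal.tsum_toReal_eq fun n => measure_ne_top p _, tsum_measure_children] at this

lemma tsum_pk_add_tsum_pk_le_one : ∑' n, pk p true k n + ∑' n, pk p false k n ≤ 1 := by
  rw [(hasSum_pk p true k).tsum_eq, (hasSum_pk p false k).tsum_eq]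
  have hd : Disjoint {s : GameS | s.1 = true ∧ k ≤ s.2.1} {s : GameS | s.1 = false ∧ k ≤ s.2.1} :=
    Set.disjoint_left.2 fun s hs hs' => by simp [hs.1] at hs'
  rw [← ENNReal.toReal_add (measure_ne_top p _) (measure_ne_top p _),
    ← measure_union hd (measurableSet_player_capacity false k)]
  exact measureReal_le_one

lemma dk_le_one_iff :
    dk p k ≤ 1 ↔ ∀ N, (∑ n ∈ Finset.range N, pk p true k n * n) + pk p false k 1 ≤ 1 := by
  have hpk : ∀ i n, p {s : GameS | s.1 = i ∧ k ≤ s.2.1 ∧ s.2.2 = n} = ENNReal.ofReal (pk p i k n) :=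
    fun i n => (ENNReal.ofReal_toReal (measure_ne_top p _)).symm
  have hnn : ∀ i n, 0 ≤ pk p i k n := fun i n => ENNReal.toReal_nonneg
  rw [dk, lintegral_children_eq_tsum p true k (fun n => (n : ℝ≥0∞)), ENNReal.tsum_eq_iSup_nat,
    ENNReal.iSup_add, iSup_le_iff]
  refine forall_congr' fun N => ?_
  have hterm : ∀ n : ℕ, (n : ℝ≥0∞) * p {s : GameS | s.1 = true ∧ k ≤ s.2.1 ∧ s.2.2 = n}
      = ENNReal.ofReal (pk p true k n * n) := fun n => by
    rw [hpk, ENNReal.ofReal_mul (hnn _ _), ENNReal.ofReal_natCast, mul_comm]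
  have hterm0 : ∀ n : ℕ, 0 ≤ pk p true k n * n := fun n =>
    mul_nonneg (hnn _ _) n.cast_nonneg
  simp_rw [hterm]
  rw [hpk, ← ENNReal.ofReal_sum_of_nonneg fun n _ => hterm0 n,
    ← ENNReal.ofReal_add (Finset.sum_nonneg fun n _ => hterm0 n) (hnn _ _),
    ENNReal.ofReal_le_one]

end Measure

/-- for `k ≥ 0`, the function `f_k` has no fixed point in `[0,1)` if and
only if `f_k(0) > 0`, `f_k(1) = 1` and `d(k) ≤ 1`. -/
theorem vgf_no_fixed_point_iff
    (p : Measure GameS) [IsProbabilityMeasure p] (k : ℝ≥0) :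
    (¬ ∃ x ∈ Set.Ico (0:ℝ) 1, vgf p k x = x) ↔
      (0 < vgf p k 0 ∧ vgf p k 1 = 1 ∧ dk p k ≤ 1) := by
  rw [dk_le_one_iff]
  refine series_no_fixed_point_iff (a := pk p true k) (b := pk p false k)
    (fun n => ENNReal.toReal_nonneg) (hasSum_pk p true k).summable
    (fun n => ENNReal.toReal_nonneg) (hasSum_pk p false k).summable
    (tsum_pk_add_tsum_pk_le_one p k) fun x => ?_
  simp only [vgf, Gk, tsum_mul_zero_pow, one_pow, mul_one]
end

section
/- Let p be a Borel probability measure on S with p({γ < k}) > 0 for every k > 0, and let (p_n) be a sequence of Borel probability measures on S converging weakly to p. Then α_{p_n}(k) → α_p(k) as n → ∞, for every k > 0 that is a point of continuity of the non-decreasing map k′ ↦ α_p(k′). -/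
open MeasureTheory Set Filter Topology
open scoped ENNReal NNReal

/-- `α_p(k)`: the smallest fixed point of `f_k` in `[0,1]`. -/
noncomputable def alphaP (p : Measure GameS) (k : ℝ≥0) : ℝ :=
  sInf {x ∈ Set.Icc (0:ℝ) 1 | vgf p k x = x}

/-- The integrand for which `vgf p k x = 1 - ∫ 1{γ ≥ k} vgfDefect x`. -/
noncomputable def vgfDefect (x : ℝ) (s : GameS) : ℝ :=
  if s.1 = true then 1 + 0 ^ s.2.2 - x ^ s.2.2 else (1 - x) ^ s.2.2

lemma continuous_vgfDefect (x : ℝ) : Continuous (vgfDefect x) := by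
  have h : vgfDefect x =
      (fun t : Bool × ℕ => if t.1 = true then 1 + 0 ^ t.2 - x ^ t.2 else (1 - x) ^ t.2) ∘
        fun s : GameS => (s.1, s.2.2) := rfl
  rw [h]
  exact continuous_of_discreteTopology.comp (by fun_prop)

lemma vgfDefect_nonneg {x : ℝ} (hx : x ∈ Icc (0 : ℝ) 1) (s : GameS) : 0 ≤ vgfDefect x s := by
  unfold vgfDefect
  split_ifs
  · have h1 : x ^ s.2.2 ≤ 1 := pow_le_one₀ hx.1 hx.2
    have h2 : (0 : ℝ) ≤ 0 ^ s.2.2 := by positivity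
    linarith
  · exact pow_nonneg (by linarith [hx.2]) _

lemma vgfDefect_anti {x y : ℝ} (hx : 0 ≤ x) (hxy : x ≤ y) (hy : y ≤ 1) (s : GameS) :
    vgfDefect y s ≤ vgfDefect x s := by
  unfold vgfDefect
  split_ifs
  · have := pow_le_pow_left₀ hx hxy s.2.2
    linarith
  · exact pow_le_pow_left₀ (by linarith) (by linarith) _

lemma vgfDefect_zero (s : GameS) : vgfDefect 0 s = 1 := by
  unfold vgfDefect
  split_ifs <;> simp

lemma vgfDefect_le_one {x : ℝ} (hx : x ∈ Icc (0 : ℝ) 1) (s : GameS) : vgfDefect x s ≤ 1 :=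
  (vgfDefect_anti le_rfl hx.1 hx.2 s).trans_eq (vgfDefect_zero s)

/-- Nonnegativity of the third divided difference of `t ↦ t ^ n` at the nodes `0, a, x, 1`,
with the denominators cleared. -/
lemma pow_third_difference_nonneg {a x : ℝ} (ha : 0 ≤ a) (hax : a ≤ x) (hx : x ≤ 1) (n : ℕ) :
    0 ≤ -0 ^ n * ((x - a) * (1 - a) * (1 - x)) + a ^ n * (x * (1 - x)) - x ^ n * (a * (1 - a))
      + a * x * (x - a) := by
  cases n with
  | zero =>
    apply le_of_eq
    ring
  | succ m =>
    have key : 0 ≤ a ^ m * (1 - x) - x ^ m * (1 - a) + (x - a) := by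
      induction m with
      | zero => simp
      | succ m ih =>
        have h1 : a ^ m ≤ x ^ m := pow_le_pow_left₀ ha hax m
        have h2 : x ^ m ≤ 1 := pow_le_one₀ (ha.trans hax) hx
        have h3 : 0 ≤ (x - a) * (1 - x) * (1 - a ^ m) := by
          apply mul_nonneg (mul_nonneg _ _) <;> linarith
        rw [pow_succ, pow_succ]
        nlinarith [mul_nonneg (ha.trans hax) ih]
    have h : 0 ≤ a * x * (a ^ m * (1 - x) - x ^ m * (1 - a) + (x - a)) :=
      mul_nonneg (mul_nonneg ha (ha.trans hax)) key
    rw [zero_pow (Nat.succ_ne_zero m), pow_succ, pow_succ]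
    linarith

lemma vgfDefect_third_difference_nonpos {a x : ℝ} (ha : 0 ≤ a) (hax : a ≤ x) (hx : x ≤ 1)
    (s : GameS) :
    -vgfDefect 0 s * ((x - a) * (1 - a) * (1 - x)) + vgfDefect a s * (x * (1 - x))
      - vgfDefect x s * (a * (1 - a)) + vgfDefect 1 s * (a * x * (x - a)) ≤ 0 := by
  unfold vgfDefect
  split_ifs
  · have := pow_third_difference_nonneg ha hax hx s.2.2
    rw [one_pow]
    linarith
  · have := pow_third_difference_nonneg (a := 1 - x) (x := 1 - a) (by linarith) (by linarith)
      (by linarith) s.2.2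
    rw [sub_zero, sub_self, one_pow]
    linarith

lemma bddBelow_vgf_fixedPoints (p : Measure GameS) (k : ℝ≥0) :
    BddBelow {x ∈ Icc (0 : ℝ) 1 | vgf p k x = x} :=
  ⟨0, fun _ hx => hx.1.1⟩

lemma measurableSet_capacity_ge (k : ℝ≥0) : MeasurableSet {s : GameS | k ≤ s.2.1} :=
  measurableSet_le measurable_const (by fun_prop)

section Measure

variable (p : Measure GameS) [IsProbabilityMeasure p]

lemma integrable_vgfDefect {x : ℝ} (hx : x ∈ Icc (0 : ℝ) 1) : Integrable (vgfDefect x) p :=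
  Integrable.of_bound (continuous_vgfDefect x).aestronglyMeasurable 1
    (.of_forall fun s => by
      rw [Real.norm_of_nonneg (vgfDefect_nonneg hx s)]
      exact vgfDefect_le_one hx s)

lemma integrable_pow_children {x : ℝ} (hx : x ∈ Icc (0 : ℝ) 1) :
    Integrable (fun s : GameS => x ^ s.2.2) p :=
  Integrable.of_bound ((continuous_of_discreteTopology (f := fun n : ℕ => x ^ n)).comp
    (by fun_prop : Continuous fun s : GameS => s.2.2)).aestronglyMeasurable 1
    (.of_forall fun s => by
      rw [Real.norm_of_nonneg (pow_nonneg hx.1 _)]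
      exact pow_le_one₀ hx.1 hx.2)

lemma hasSum_pk_mul_pow {x : ℝ} (hx : x ∈ Icc (0 : ℝ) 1) (i : Bool) (k : ℝ≥0) :
    HasSum (fun n => pk p i k n * x ^ n)
      (∫ s in {s : GameS | s.1 = i ∧ k ≤ s.2.1}, x ^ s.2.2 ∂p) := by
  have hU : {s : GameS | s.1 = i ∧ k ≤ s.2.1} =
      ⋃ n, {s : GameS | s.1 = i ∧ k ≤ s.2.1 ∧ s.2.2 = n} := by
    ext s
    simp
  have hmeas : ∀ n, MeasurableSet {s : GameS | s.1 = i ∧ k ≤ s.2.1 ∧ s.2.2 = n} := fun n =>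
    (measurable_fst (measurableSet_singleton i)).inter
      ((measurableSet_capacity_ge k).inter
        ((measurable_snd.comp measurable_snd) (measurableSet_singleton n)))
  have hdisj : Pairwise (Function.onFun Disjoint
      fun n => {s : GameS | s.1 = i ∧ k ≤ s.2.1 ∧ s.2.2 = n}) := fun m n hmn =>
    Set.disjoint_left.2 fun s hs ht => hmn (hs.2.2.symm.trans ht.2.2)
  have hpk : ∀ n, ∫ s in {s : GameS | s.1 = i ∧ k ≤ s.2.1 ∧ s.2.2 = n}, x ^ s.2.2 ∂p =
      pk p i k n * x ^ n := fun n => by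
    rw [setIntegral_congr_fun (g := fun _ => x ^ n) (hmeas n)
      (fun s hs => congrArg (x ^ ·) hs.2.2), setIntegral_const]
    rfl
  rw [hU]
  simpa only [hpk] using
    hasSum_integral_iUnion hmeas hdisj (integrable_pow_children p hx).integrableOn

lemma vgf_eq_one_sub_setIntegral {x : ℝ} (hx : x ∈ Icc (0 : ℝ) 1) (k : ℝ≥0) :
    vgf p k x = 1 - ∫ s in {s : GameS | k ≤ s.2.1}, vgfDefect x s ∂p := by
  have hG : ∀ i, ∀ y ∈ Icc (0 : ℝ) 1, Gk p i k y =
      ∫ s in {s : GameS | s.1 = i ∧ k ≤ s.2.1}, y ^ s.2.2 ∂p :=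
    fun i y hy => (hasSum_pk_mul_pow p hy i k).tsum_eq
  have hmeas : ∀ i, MeasurableSet {s : GameS | s.1 = i ∧ k ≤ s.2.1} := fun i =>
    (measurable_fst (measurableSet_singleton i)).inter (measurableSet_capacity_ge k)
  have hint := fun y (hy : y ∈ Icc (0 : ℝ) 1) => integrable_pow_children p hy
  have hsplit : {s : GameS | k ≤ s.2.1} =
      {s : GameS | s.1 = true ∧ k ≤ s.2.1} ∪ {s : GameS | s.1 = false ∧ k ≤ s.2.1} := by
    ext ⟨i, s⟩
    cases i <;> simp
  have h0 : (0 : ℝ) ∈ Icc (0 : ℝ) 1 := by simp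
  have h1 : (1 : ℝ) ∈ Icc (0 : ℝ) 1 := by simp
  have hx' : 1 - x ∈ Icc (0 : ℝ) 1 := ⟨by linarith [hx.2], by linarith [hx.1]⟩
  have hT : ∫ s in {s : GameS | s.1 = true ∧ k ≤ s.2.1}, vgfDefect x s ∂p =
      Gk p true k 0 + Gk p true k 1 - Gk p true k x := by
    rw [hG _ _ h0, hG _ _ h1, hG _ _ hx,
      ← integral_add (hint 0 h0).integrableOn (hint 1 h1).integrableOn,
      ← integral_sub (f := fun s : GameS => (0 : ℝ) ^ s.2.2 + 1 ^ s.2.2)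
        ((hint 0 h0).add (hint 1 h1)).integrableOn (hint x hx).integrableOn]
    refine setIntegral_congr_fun (hmeas true) fun s hs => ?_
    simp only [vgfDefect, hs.1, if_true, one_pow]
    ring
  have hF : ∫ s in {s : GameS | s.1 = false ∧ k ≤ s.2.1}, vgfDefect x s ∂p =
      Gk p false k (1 - x) := by
    rw [hG _ _ hx']
    refine setIntegral_congr_fun (hmeas false) fun s hs => ?_
    simp [vgfDefect, hs.1]
  rw [hsplit, setIntegral_union ?_ (hmeas false) (integrable_vgfDefect p hx).integrableOn
    (integrable_vgfDefect p hx).integrableOn, hT, hF]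
  · unfold vgf
    ring
  · exact Set.disjoint_left.2 fun s hs ht => by simp [hs.1] at ht

lemma continuousOn_Gk (i : Bool) (k : ℝ≥0) : ContinuousOn (Gk p i k) (Icc 0 1) := by
  have hsum : Summable (pk p i k) := by
    simpa using (hasSum_pk_mul_pow p (x := 1) (by simp) i k).summable
  refine continuousOn_tsum (fun n => by fun_prop) hsum fun n x hx => ?_
  have hp : 0 ≤ pk p i k n := ENNReal.toReal_nonneg
  rw [Real.norm_of_nonneg (mul_nonneg hp (pow_nonneg hx.1 n))]
  exact mul_le_of_le_one_right hp (pow_le_one₀ hx.1 hx.2)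

lemma continuousOn_vgf (k : ℝ≥0) : ContinuousOn (vgf p k) (Icc 0 1) := by
  have h : ContinuousOn (fun x => Gk p false k (1 - x)) (Icc 0 1) :=
    (continuousOn_Gk p false k).comp (by fun_prop)
      fun x hx => ⟨by linarith [hx.2], by linarith [hx.1]⟩
  exact (continuousOn_const.add (continuousOn_Gk p true k)).sub h

lemma monotoneOn_vgf (k : ℝ≥0) : MonotoneOn (vgf p k) (Icc 0 1) := by
  intro x hx y hy hxy
  rw [vgf_eq_one_sub_setIntegral p hx, vgf_eq_one_sub_setIntegral p hy]
  exact sub_le_sub_left (integral_mono (integrable_vgfDefect p hy).integrableOn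
    (integrable_vgfDefect p hx).integrableOn (vgfDefect_anti hx.1 hxy hy.2)) 1

lemma vgf_zero (k : ℝ≥0) : vgf p k 0 = p.real {s : GameS | s.2.1 < k} := by
  have hc : {s : GameS | s.2.1 < k} = {s : GameS | k ≤ s.2.1}ᶜ := by
    ext s
    simp
  rw [vgf_eq_one_sub_setIntegral p (by simp), hc,
    probReal_compl_eq_one_sub (measurableSet_capacity_ge k)]
  simp [vgfDefect_zero]

lemma vgf_one_le (k : ℝ≥0) : vgf p k 1 ≤ 1 := by
  rw [vgf_eq_one_sub_setIntegral p (by simp)]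
  exact sub_le_self _ (integral_nonneg (vgfDefect_nonneg (by simp)))

lemma vgf_third_difference_nonneg {a x : ℝ} (ha : 0 ≤ a) (hax : a ≤ x) (hx : x ≤ 1) (k : ℝ≥0) :
    0 ≤ -vgf p k 0 * ((x - a) * (1 - a) * (1 - x)) + vgf p k a * (x * (1 - x))
      - vgf p k x * (a * (1 - a)) + vgf p k 1 * (a * x * (x - a)) := by
  have h0 : (0 : ℝ) ∈ Icc (0 : ℝ) 1 := by simp
  have h1 : (1 : ℝ) ∈ Icc (0 : ℝ) 1 := by simp
  have ha' : a ∈ Icc (0 : ℝ) 1 := ⟨ha, hax.trans hx⟩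
  have hx' : x ∈ Icc (0 : ℝ) 1 := ⟨ha.trans hax, hx⟩
  have I := fun (y : ℝ) (hy : y ∈ Icc (0 : ℝ) 1) (c : ℝ) =>
    ((integrable_vgfDefect p hy).mul_const c).integrableOn (s := {s : GameS | k ≤ s.2.1})
  have key := integral_nonpos (μ := p.restrict {s : GameS | k ≤ s.2.1})
    (vgfDefect_third_difference_nonpos ha hax hx)
  simp only [neg_mul] at key
  rw [integral_add, integral_sub, integral_add, integral_neg, integral_mul_const,
    integral_mul_const, integral_mul_const, integral_mul_const] at key
  · rw [vgf_eq_one_sub_setIntegral p h0, vgf_eq_one_sub_setIntegral p h1,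
      vgf_eq_one_sub_setIntegral p ha', vgf_eq_one_sub_setIntegral p hx']
    linarith
  · exact (I 0 h0 _).neg
  · exact I a ha' _
  · exact (I 0 h0 _).neg.add (I a ha' _)
  · exact I x hx' _
  · exact ((I 0 h0 _).neg.add (I a ha' _)).sub (I x hx' _)
  · exact I 1 h1 _

lemma alphaP_le_of_vgf_le {k : ℝ≥0} {x : ℝ} (hx : x ∈ Icc (0 : ℝ) 1) (h : vgf p k x ≤ x) :
    alphaP p k ≤ x := by
  have hc : ContinuousOn (fun y => vgf p k y - y) (Icc 0 x) :=
    ((continuousOn_vgf p k).mono (Icc_subset_Icc_right hx.2)).sub continuousOn_id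
  have h0 : 0 ≤ vgf p k 0 := by
    rw [vgf_zero]
    exact measureReal_nonneg
  obtain ⟨y, hy, hy0⟩ := intermediate_value_Icc' hx.1 hc
    (show (0 : ℝ) ∈ Icc _ _ from ⟨by linarith, by linarith⟩)
  exact (csInf_le (bddBelow_vgf_fixedPoints p k)
    ⟨⟨hy.1, hy.2.trans hx.2⟩, sub_eq_zero.1 hy0⟩).trans hy.2

lemma alphaP_mem (k : ℝ≥0) : alphaP p k ∈ {x ∈ Icc (0 : ℝ) 1 | vgf p k x = x} := by
  have hc : ContinuousOn (fun y => vgf p k y - y) (Icc 0 1) :=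
    (continuousOn_vgf p k).sub continuousOn_id
  have h0 : 0 ≤ vgf p k 0 := by
    rw [vgf_zero]
    exact measureReal_nonneg
  have hset : {x ∈ Icc (0 : ℝ) 1 | vgf p k x = x} =
      Icc 0 1 ∩ (fun y => vgf p k y - y) ⁻¹' {0} := by
    ext x
    simp [sub_eq_zero]
  refine IsClosed.csInf_mem ?_ ?_ (bddBelow_vgf_fixedPoints p k)
  · rw [hset]
    exact hc.preimage_isClosed_of_isClosed isClosed_Icc isClosed_singleton
  · obtain ⟨y, hy, hy0⟩ := intermediate_value_Icc' zero_le_one hc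
      (show (0 : ℝ) ∈ Icc _ _ from ⟨by linarith [vgf_one_le p k], by linarith⟩)
    exact ⟨y, hy, sub_eq_zero.1 hy0⟩

/-- The vgf lies strictly below the diagonal between its smallest fixed point and `1`. -/
lemma vgf_lt_of_alphaP_lt {k : ℝ≥0} (hk : 0 < p {s : GameS | s.2.1 < k}) {x : ℝ}
    (hαx : alphaP p k < x) (hx : x < 1) : vgf p k x < x := by
  obtain ⟨⟨hα0, -⟩, hfix⟩ := alphaP_mem p k
  have hf0 : 0 < vgf p k 0 := by
    rw [vgf_zero]
    exact ENNReal.toReal_pos hk.ne' (measure_ne_top p _)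
  have hα : 0 < alphaP p k := hα0.lt_of_ne fun h => by
    rw [← h] at hfix
    exact hf0.ne' hfix
  have hD := vgf_third_difference_nonneg p hα0 hαx.le hx.le k
  rw [hfix] at hD
  set a := alphaP p k
  have hxa : 0 < x - a := sub_pos.2 hαx
  have hx1 : 0 < 1 - x := sub_pos.2 hx
  have ha1 : 0 < 1 - a := by linarith
  have e0 : 0 < vgf p k 0 * ((x - a) * (1 - a) * (1 - x)) := by positivity
  have e1 : 0 ≤ (1 - vgf p k 1) * (a * x * (x - a)) :=
    mul_nonneg (sub_nonneg.2 (vgf_one_le p k))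
      (mul_nonneg (mul_nonneg hα0 (hα0.trans hαx.le)) hxa.le)
  have e : 0 < (x - vgf p k x) * (a * (1 - a)) := by nlinarith
  exact sub_pos.1 (pos_of_mul_pos_left e (by positivity))

end Measure

/-- Weak convergence sandwich: a single continuous cutoff between `1{γ ≥ k'}` and `1{γ ≥ k}`
compares the limit of the vgf at one level with the vgf of the limit at the other. -/
lemma exists_tendsto_vgf_sandwich {p : ProbabilityMeasure GameS}
    {pn : ℕ → ProbabilityMeasure GameS} (hconv : Tendsto pn atTop (𝓝 p)) {k k' : ℝ≥0}
    (hk : k < k') {x : ℝ} (hx : x ∈ Icc (0 : ℝ) 1) :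
    ∃ (u : ℕ → ℝ) (l : ℝ), Tendsto u atTop (𝓝 l) ∧
      (∀ n, vgf (pn n : Measure GameS) k x ≤ u n ∧ u n ≤ vgf (pn n : Measure GameS) k' x) ∧
      vgf (p : Measure GameS) k x ≤ l ∧ l ≤ vgf (p : Measure GameS) k' x := by
  let φ : GameS → ℝ := fun s => max 0 (min 1 (((s.2.1 : ℝ) - k) / ((k' : ℝ) - k)))
  have hkk : (0 : ℝ) < k' - k := sub_pos.2 (NNReal.coe_lt_coe.2 hk)
  have hφ : Continuous φ := by
    have : ((k' : ℝ) - k) ≠ 0 := hkk.ne'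
    fun_prop
  have hφ0 : ∀ s, 0 ≤ φ s := fun s => le_max_left _ _
  have hφ1 : ∀ s, φ s ≤ 1 := fun s => max_le zero_le_one (min_le_left _ _)
  have hFc : Continuous fun s => φ s * vgfDefect x s := hφ.mul (continuous_vgfDefect x)
  have hFb : ∀ s, ‖φ s * vgfDefect x s‖ ≤ 1 := fun s => by
    rw [Real.norm_of_nonneg (mul_nonneg (hφ0 s) (vgfDefect_nonneg hx s))]
    exact mul_le_one₀ (hφ1 s) (vgfDefect_nonneg hx s) (vgfDefect_le_one hx s)
  have hlim := (ProbabilityMeasure.tendsto_iff_forall_integral_tendsto.1 hconv)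
    (BoundedContinuousFunction.ofNormedAddCommGroup _ hFc 1 hFb)
  have hcmp : ∀ q : ProbabilityMeasure GameS,
      vgf (q : Measure GameS) k x ≤ 1 - ∫ s, φ s * vgfDefect x s ∂(q : Measure GameS) ∧
      1 - ∫ s, φ s * vgfDefect x s ∂(q : Measure GameS) ≤ vgf (q : Measure GameS) k' x := by
    intro q
    have hFi : Integrable (fun s => φ s * vgfDefect x s) (q : Measure GameS) :=
      Integrable.of_bound hFc.aestronglyMeasurable 1 (.of_forall hFb)
    have hi := integrable_vgfDefect (q : Measure GameS) hx
    rw [vgf_eq_one_sub_setIntegral _ hx, vgf_eq_one_sub_setIntegral _ hx,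
      ← integral_indicator (measurableSet_capacity_ge k),
      ← integral_indicator (measurableSet_capacity_ge k')]
    refine ⟨sub_le_sub_left (integral_mono hFi
      (hi.indicator (measurableSet_capacity_ge k)) fun s => ?_) 1,
      sub_le_sub_left (integral_mono (hi.indicator (measurableSet_capacity_ge k')) hFi
        fun s => ?_) 1⟩
    · by_cases hs : k ≤ s.2.1
      · simpa [indicator, hs] using
          mul_le_of_le_one_left (vgfDefect_nonneg hx s) (hφ1 s)
      · have hs' : (s.2.1 : ℝ) - k ≤ 0 :=
          sub_nonpos.2 (NNReal.coe_le_coe.2 (not_le.1 hs).le)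
        have : φ s = 0 := max_eq_left
          ((min_le_right _ _).trans (div_nonpos_of_nonpos_of_nonneg hs' hkk.le))
        simp [indicator, hs, this]
    · by_cases hs : k' ≤ s.2.1
      · have hs' : (1 : ℝ) ≤ ((s.2.1 : ℝ) - k) / ((k' : ℝ) - k) := by
          rw [one_le_div hkk]
          exact sub_le_sub_right (NNReal.coe_le_coe.2 hs) _
        have : φ s = 1 := by simp [φ, min_eq_left hs']
        simp [indicator, hs, this]
      · simpa [indicator, hs] using mul_nonneg (hφ0 s) (vgfDefect_nonneg hx s)
  exact ⟨fun n => 1 - ∫ s, φ s * vgfDefect x s ∂(pn n : Measure GameS), _,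
    tendsto_const_nhds.sub hlim, fun n => hcmp (pn n), hcmp p⟩

lemma eventually_vgf_lt {p : ProbabilityMeasure GameS}
    {pn : ℕ → ProbabilityMeasure GameS} (hconv : Tendsto pn atTop (𝓝 p)) {k k' : ℝ≥0}
    (hk : k < k') {x c : ℝ} (hx : x ∈ Icc (0 : ℝ) 1) (hc : vgf (p : Measure GameS) k' x < c) :
    ∀ᶠ n in atTop, vgf (pn n : Measure GameS) k x < c := by
  obtain ⟨u, l, hu, hn, -, hl⟩ := exists_tendsto_vgf_sandwich hconv hk hx
  filter_upwards [hu.eventually_lt_const (hl.trans_lt hc)] with n h using (hn n).1.trans_lt h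

lemma eventually_lt_vgf {p : ProbabilityMeasure GameS}
    {pn : ℕ → ProbabilityMeasure GameS} (hconv : Tendsto pn atTop (𝓝 p)) {k k' : ℝ≥0}
    (hk : k < k') {x c : ℝ} (hx : x ∈ Icc (0 : ℝ) 1) (hc : c < vgf (p : Measure GameS) k x) :
    ∀ᶠ n in atTop, c < vgf (pn n : Measure GameS) k' x := by
  obtain ⟨u, l, hu, hn, hl, -⟩ := exists_tendsto_vgf_sandwich hconv hk hx
  filter_upwards [hu.eventually_const_lt (hc.trans_le hl)] with n h using h.trans_le (hn n).2

lemma eventually_alphaP_lt {p : ProbabilityMeasure GameS}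
    {pn : ℕ → ProbabilityMeasure GameS} (hconv : Tendsto pn atTop (𝓝 p)) {k k' : ℝ≥0}
    (hk : k < k') (hpos : 0 < (p : Measure GameS) {s : GameS | s.2.1 < k'}) {c : ℝ}
    (hc : alphaP (p : Measure GameS) k' < c) :
    ∀ᶠ n in atTop, alphaP (pn n : Measure GameS) k < c := by
  rcases lt_or_ge 1 c with h1 | h1
  · exact .of_forall fun n => (alphaP_mem (pn n : Measure GameS) k).1.2.trans_lt h1
  obtain ⟨x, hαx, hxc⟩ := exists_between hc
  have hx : x ∈ Icc (0 : ℝ) 1 :=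
    ⟨(alphaP_mem (p : Measure GameS) k').1.1.trans hαx.le, hxc.le.trans h1⟩
  filter_upwards [eventually_vgf_lt hconv hk hx
    (vgf_lt_of_alphaP_lt (p : Measure GameS) hpos hαx (hxc.trans_le h1))] with n hn
  exact (alphaP_le_of_vgf_le (pn n : Measure GameS) hx hn.le).trans_lt hxc

lemma eventually_lt_alphaP {p : ProbabilityMeasure GameS}
    {pn : ℕ → ProbabilityMeasure GameS} (hconv : Tendsto pn atTop (𝓝 p)) {k k' : ℝ≥0}
    (hk : k < k') {c : ℝ} (hc : c < alphaP (p : Measure GameS) k) :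
    ∀ᶠ n in atTop, c < alphaP (pn n : Measure GameS) k' := by
  have hc1 : c < 1 := hc.trans_le (alphaP_mem (p : Measure GameS) k).1.2
  suffices h : ∀ᶠ n in atTop, ∀ y ∈ Icc 0 c, y < vgf (pn n : Measure GameS) k' y by
    filter_upwards [h] with n hn
    obtain ⟨⟨h0, -⟩, hfix⟩ := alphaP_mem (pn n : Measure GameS) k'
    by_contra! hle
    exact (hn _ ⟨h0, hle⟩).ne' hfix
  refine isCompact_Icc.induction_on
    (p := fun t => ∀ᶠ n in atTop, ∀ y ∈ t, y < vgf (pn n : Measure GameS) k' y)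
    (by simp) (fun s t hst ht => ht.mono fun n hn y hy => hn y (hst hy))
    (fun s t hs ht => by
      filter_upwards [hs, ht] with n h1 h2 y hy
      exact hy.elim (h1 y) (h2 y)) fun y hy => ?_
  have hy1 : y ∈ Icc (0 : ℝ) 1 := ⟨hy.1, hy.2.trans hc1.le⟩
  have hlt : y < vgf (p : Measure GameS) k y := by
    by_contra! hle
    exact absurd (alphaP_le_of_vgf_le (p : Measure GameS) hy1 hle) (not_le.2 (hy.2.trans_lt hc))
  obtain ⟨b, hyb, hb⟩ := exists_between hlt
  have hev : ∀ᶠ z in 𝓝[Icc 0 1] y, b < vgf (p : Measure GameS) k z :=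
    ((continuousOn_vgf (p : Measure GameS) k) y hy1).eventually_const_lt hb
  obtain ⟨δ, hδ, hball⟩ := Metric.mem_nhdsWithin_iff.1 hev
  set z := max 0 (y - δ / 2) with hz
  have hzy : z ≤ y := max_le hy.1 (by linarith)
  have hz1 : z ∈ Icc (0 : ℝ) 1 := ⟨le_max_left _ _, hzy.trans hy1.2⟩
  have hbz : b < vgf (p : Measure GameS) k z := hball ⟨by
    rw [Metric.mem_ball, Real.dist_eq, abs_lt]
    constructor <;> linarith [le_max_right 0 (y - δ / 2)], hz1⟩
  refine ⟨Ioo (y - δ / 2) b ∩ Icc 0 c, ?_, ?_⟩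
  · exact inter_mem (mem_nhdsWithin_of_mem_nhds (Ioo_mem_nhds (by linarith) hyb))
      self_mem_nhdsWithin
  · filter_upwards [eventually_lt_vgf hconv hk hz1 hbz] with n hn w hw
    exact hw.1.2.trans (hn.trans_le (monotoneOn_vgf (pn n : Measure GameS) k' hz1
      ⟨hw.2.1, hw.2.2.trans hc1.le⟩ (max_le hw.2.1 hw.1.1.le)))

/-- if `p({γ < k}) > 0` for every `k > 0` and `p_n → p` weakly, then
`α_{p_n}(k) → α_p(k)` for every `k > 0` at which `k′ ↦ α_p(k′)` is continuous. -/
theorem alphaP_tendsto_of_weak_convergence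
    (p : ProbabilityMeasure GameS) (pn : ℕ → ProbabilityMeasure GameS)
    (hconv : Tendsto pn atTop (nhds p))
    (hpos : ∀ k : ℝ≥0, 0 < k → 0 < (p : Measure GameS) {s : GameS | s.2.1 < k}) :
    ∀ k : ℝ≥0, 0 < k →
      ContinuousAt (fun k' : ℝ≥0 => alphaP (p : Measure GameS) k') k →
      Tendsto (fun n : ℕ => alphaP (pn n : Measure GameS) k) atTop
        (nhds (alphaP (p : Measure GameS) k)) := by
  intro k hk hcont
  refine tendsto_order.2 ⟨fun c hc => ?_, fun c hc => ?_⟩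
  · have : (𝓝[<] k).NeBot := nhdsLT_neBot_of_exists_lt ⟨0, hk⟩
    obtain ⟨k', hk', hlt⟩ := ((hcont.eventually_const_lt hc).filter_mono nhdsWithin_le_nhds
      |>.and self_mem_nhdsWithin : ∀ᶠ k' in 𝓝[<] k, _).exists
    exact eventually_lt_alphaP hconv hlt hk'
  · obtain ⟨k', hk', hlt⟩ := ((hcont.eventually_lt_const hc).filter_mono nhdsWithin_le_nhds
      |>.and self_mem_nhdsWithin : ∀ᶠ k' in 𝓝[>] k, _).exists
    exact eventually_alphaP_lt hconv hlt (hpos k' (hk.trans hlt)) hk'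
end
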